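/- arXiv:1902.10349 — 9 statements merged into one kernel-verified Lean document; each statement's English description precedes it below -/
import Mathlib

section
/- Let G be a simple graph on a finite vertex set V and let k be a natural number with k ≤ |V|. Then G contains a clique of size k (a set of k pairwise adjacent vertices) if and only if there exist functions v : V → {0,1} and x : E(G) → {0,1} (where E(G) is the edge set of G) such that: (i) for every edge e = {i,j} of G, x(e) ≥ v(i) + v(j) − 1, x(e) ≤ v(i), and x(e) ≤ v(j); (ii) Σ_{i ∈ V} v(i) = k; and (iii) Σ_{e ∈ E(G)} x(e) = k(k−1)/2. -/
/-- The number of ones in a sum of zeros and ones. -/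
theorem sum_eq_card_filter_one {α : Type*} (s : Finset α) (f : α → ℤ)
    (hf : ∀ a ∈ s, f a = 0 ∨ f a = 1) :
    ∑ a ∈ s, f a = ((s.filter fun a => f a = 1).card : ℤ) := by
  rw [Finset.card_filter]
  push_cast
  refine Finset.sum_congr rfl fun a ha => ?_
  rcases hf a ha with h | h <;> simp [h]

/-- The unordered pairs of distinct elements of `s` are the image of its off-diagonal. -/
theorem mk_mem_image_offDiag {α : Type*} [DecidableEq α] (s : Finset α) (a b : α) :
    s(a, b) ∈ s.offDiag.image (Sym2.mk.uncurry) ↔ a ∈ s ∧ b ∈ s ∧ a ≠ b := by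
  simp only [Finset.mem_image, Finset.mem_offDiag, Prod.exists, Function.uncurry, Sym2.eq_iff]
  grind

/-- Correctness of the reduction from Clique to 0-1 Integer Programming. -/
theorem clique_to_zero_one_IP {V : Type*} [Fintype V] [DecidableEq V]
    (G : SimpleGraph V) [DecidableRel G.Adj] (k : ℕ) (hk : k ≤ Fintype.card V) :
    (∃ s : Finset V, G.IsNClique k s) ↔
    ∃ (v : V → ℤ) (x : Sym2 V → ℤ),
      (∀ i, v i = 0 ∨ v i = 1) ∧
      (∀ e ∈ G.edgeFinset, x e = 0 ∨ x e = 1) ∧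
      (∀ i j, G.Adj i j →
        v i + v j - 1 ≤ x s(i, j) ∧ x s(i, j) ≤ v i ∧ x s(i, j) ≤ v j) ∧
      (∑ i, v i = (k : ℤ)) ∧
      (∑ e ∈ G.edgeFinset, x e = ((k * (k - 1) / 2 : ℕ) : ℤ)) := by
  rw [← Nat.choose_two_right]
  constructor
  · rintro ⟨s, hs, hcard⟩
    have hsub : s.offDiag.image (Sym2.mk.uncurry) ⊆ G.edgeFinset := by
      intro e
      induction e with
      | h a b =>
        rw [mk_mem_image_offDiag, SimpleGraph.mem_edgeFinset, SimpleGraph.mem_edgeSet]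
        rintro ⟨ha, hb, hab⟩
        exact hs ha hb hab
    refine ⟨fun i => if i ∈ s then 1 else 0,
      fun e => if e ∈ s.offDiag.image (Sym2.mk.uncurry) then 1 else 0, ?_, ?_, ?_, ?_, ?_⟩
    · intro i
      by_cases h : i ∈ s <;> simp [h]
    · intro e _
      dsimp only
      split_ifs <;> simp
    · intro i j hij
      have hne := hij.ne
      simp only [mk_mem_image_offDiag]
      by_cases hi : i ∈ s <;> by_cases hj : j ∈ s <;> simp [hi, hj, hne]
    · simp [hcard]
    · rw [Finset.sum_ite_mem, Finset.inter_eq_right.mpr hsub, Finset.sum_const,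
        Sym2.card_image_offDiag, hcard]
      simp
  · rintro ⟨v, x, hv, hx, hvx, hsv, hsx⟩
    rw [sum_eq_card_filter_one _ _ fun i _ => hv i] at hsv
    rw [sum_eq_card_filter_one _ _ hx] at hsx
    set s := Finset.univ.filter fun i => v i = 1 with hs
    have hcard : s.card = k := by exact_mod_cast hsv
    have hsub : (G.edgeFinset.filter fun e => x e = 1) ⊆ s.offDiag.image (Sym2.mk.uncurry) := by
      intro e
      induction e with
      | h a b =>
        rw [mk_mem_image_offDiag, Finset.mem_filter, SimpleGraph.mem_edgeFinset,
          SimpleGraph.mem_edgeSet]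
        rintro ⟨hab, h1⟩
        obtain ⟨-, ha, hb⟩ := hvx a b hab
        have hva := hv a
        have hvb := hv b
        refine ⟨?_, ?_, hab.ne⟩ <;> simp only [hs, Finset.mem_filter_univ] <;> omega
    have heq := Finset.eq_of_subset_of_card_le hsub (by
      rw [Sym2.card_image_offDiag, hcard]
      exact_mod_cast hsx.ge)
    refine ⟨s, fun a ha b hb hab => ?_, hcard⟩
    have hmem := (mk_mem_image_offDiag s a b).mpr ⟨ha, hb, hab⟩
    rw [← heq, Finset.mem_filter, SimpleGraph.mem_edgeFinset] at hmem
    exact hmem.1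
end

section
/- Let G be a simple graph on a finite vertex set V and let l be a natural number. For each vertex j ∈ V let S_j denote the set of edges of G incident with j. Then G has a vertex cover of size at most l (a set of at most l vertices such that every edge of G is incident with at least one of them) if and only if there exists a subset W ⊆ V with |W| ≤ l such that the union ⋃_{j ∈ W} S_j equals the union ⋃_{j ∈ V} S_j, i.e., equals the full edge set of G. -/
/-- Correctness of Karp's reduction from Node Cover (Vertex Cover) to Set
Covering: the set associated with a vertex `j` is the set of edges incident
with `j`. -/
theorem node_cover_to_set_covering {V : Type*} [Fintype V] [DecidableEq V]
    (G : SimpleGraph V) [DecidableRel G.Adj] (l : ℕ) :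
    (∃ C : Finset V, C.card ≤ l ∧ ∀ i j, G.Adj i j → i ∈ C ∨ j ∈ C) ↔
    ∃ W : Finset V, W.card ≤ l ∧
      W.biUnion (fun j => G.incidenceFinset j) = G.edgeFinset := by
  refine exists_congr fun C => and_congr_right fun _ => ?_
  simp only [Finset.ext_iff, Finset.mem_biUnion, SimpleGraph.mem_incidenceFinset,
    SimpleGraph.mem_edgeFinset, SimpleGraph.incidenceSet, Set.mem_ofPred_eq]
  constructor
  · intro hC e
    refine ⟨fun ⟨_, _, he, _⟩ => he, ?_⟩
    induction e with
    | _ i j =>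
      intro he
      rcases hC i j he with hi | hj
      · exact ⟨i, hi, he, Sym2.mem_mk_left i j⟩
      · exact ⟨j, hj, he, Sym2.mem_mk_right i j⟩
  · intro hC i j hij
    obtain ⟨k, hk, _, hmem⟩ := (hC s(i, j)).2 hij
    rcases Sym2.mem_iff.1 hmem with rfl | rfl
    · exact Or.inl hk
    · exact Or.inr hk
end

section
/- Let U be a finite set, let S₁, …, S_s be finite subsets of U with ⋃_{i=1}^{s} S_i = U, and let k be a natural number with k ≤ s. Then there exists a set I ⊆ {1,…,s} with |I| ≤ k and ⋃_{i ∈ I} S_i = U, if and only if there exists x : {1,…,s} → {0,1} such that for every j ∈ U, Σ_{i : j ∈ S_i} x(i) ≥ 1, and Σ_{i=1}^{s} x(i) = k. -/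
/-- Correctness of the reduction from Set Covering to 0-1 Integer Programming. -/
theorem set_covering_to_zero_one_IP {U : Type*} [Fintype U] [DecidableEq U]
    (s : ℕ) (S : Fin s → Finset U)
    (hU : Finset.univ.biUnion S = (Finset.univ : Finset U))
    (k : ℕ) (hk : k ≤ s) :
    (∃ I : Finset (Fin s), I.card ≤ k ∧ I.biUnion S = (Finset.univ : Finset U)) ↔
    ∃ x : Fin s → ℕ, (∀ i, x i ≤ 1) ∧
      (∀ j : U, 1 ≤ ∑ i ∈ Finset.univ.filter (fun i => j ∈ S i), x i) ∧
      ∑ i, x i = k := by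
  constructor
  · rintro ⟨I, hI, hcover⟩
    obtain ⟨T, hIT, hT⟩ := Finset.exists_superset_card_eq hI (by simpa using hk)
    refine ⟨fun i => if i ∈ T then 1 else 0, fun i => by dsimp only; split_ifs <;> simp,
      fun j => ?_, by simpa using hT⟩
    obtain ⟨i, hi, hj⟩ := Finset.mem_biUnion.1 (hcover ▸ Finset.mem_univ j)
    calc 1 = if i ∈ T then 1 else 0 := by simp [hIT hi]
      _ ≤ _ := Finset.single_le_sum (f := fun i => if i ∈ T then 1 else 0)
        (fun _ _ => Nat.zero_le _) (by simpa using hj)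
  · rintro ⟨x, hx, hcover, hsum⟩
    refine ⟨Finset.univ.filter (fun i => x i ≠ 0), ?_, ?_⟩
    · rw [← hsum, Finset.card_filter]
      refine Finset.sum_le_sum fun i _ => ?_
      split_ifs <;> omega
    · ext j
      obtain ⟨i, hi, hne⟩ := Finset.exists_ne_zero_of_sum_ne_zero
        (Nat.one_le_iff_ne_zero.1 (hcover j))
      simp only [Finset.mem_biUnion, Finset.mem_filter, Finset.mem_univ, true_and, iff_true]
      exact ⟨i, hne, (Finset.mem_filter.1 hi).2⟩
end

section
/- Let V be a finite type, let A : V → V → Prop be the arc relation of a directed graph, and let F be a set of pairs (u,v) with A u v. Define the arc-deleted relation A' by A' u v ↔ (A u v ∧ (u,v) ∉ F). Define the line digraph relation L on pairs of vertices by L (u,v) (v',w) ↔ (A u v ∧ A v' w ∧ v = v'), and define the vertex-deleted line relation L' by L' e f ↔ (L e f ∧ e ∉ F ∧ f ∉ F). Then there exists a vertex v ∈ V lying on a directed cycle of A' (i.e., the transitive closure of A' relates v to itself) if and only if there exists an arc e ∉ F, with e a pair satisfying A, lying on a directed cycle of L' (i.e., the transitive closure of L' relates e to itself). -/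
/-- A walk in `R` that starts with the arc `(u, v)` and ends with a later arc `(w, x)` lifts to a
nonempty walk from `(u, v)` to `(w, x)` in any relation joining consecutive arcs of `R`. -/
theorem transGen_arcs_of_reflTransGen {V : Type*} {R : V → V → Prop} {S : V × V → V × V → Prop}
    (hS : ∀ {u v w}, R u v → R v w → S (u, v) (v, w)) {u v w x : V}
    (huv : R u v) (hvw : Relation.ReflTransGen R v w) (hwx : R w x) :
    Relation.TransGen S (u, v) (w, x) := by
  induction hvw generalizing x with
  | refl => exact .single (hS huv hwx)
  | tail _ hbc ih => exact (ih hbc).tail (hS hbc hwx)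

/-- Key correspondence in the reduction from Feedback Arc Set to Feedback Node
Set: the arc-deleted digraph has a directed cycle iff the vertex-deleted line
digraph has a directed cycle. -/
theorem feedback_arc_to_feedback_node {V : Type*} [Fintype V]
    (A : V → V → Prop) (F : Set (V × V)) (hF : ∀ p ∈ F, A p.1 p.2)
    (A' : V → V → Prop) (hA' : ∀ u v, A' u v ↔ A u v ∧ (u, v) ∉ F)
    (L L' : V × V → V × V → Prop)
    (hL : ∀ e f, L e f ↔ A e.1 e.2 ∧ A f.1 f.2 ∧ e.2 = f.1)
    (hL' : ∀ e f, L' e f ↔ L e f ∧ e ∉ F ∧ f ∉ F) :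
    (∃ v : V, Relation.TransGen A' v v) ↔
    (∃ e : V × V, A e.1 e.2 ∧ e ∉ F ∧ Relation.TransGen L' e e) := by
  constructor
  · rintro ⟨v, hv⟩
    obtain ⟨b, hvb, hbv⟩ := Relation.TransGen.head'_iff.mp hv
    obtain ⟨hA, hnF⟩ := (hA' v b).mp hvb
    refine ⟨(v, b), hA, hnF, transGen_arcs_of_reflTransGen (fun h₁ h₂ => ?_) hvb hbv hvb⟩
    rw [hA'] at h₁ h₂
    exact (hL' _ _).mpr ⟨(hL _ _).mpr ⟨h₁.1, h₂.1, rfl⟩, h₁.2, h₂.2⟩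
  · rintro ⟨e, -, -, he⟩
    refine ⟨e.1, he.lift Prod.fst fun f g hfg => ?_⟩
    obtain ⟨hfg, hf, -⟩ := (hL' f g).mp hfg
    obtain ⟨hAf, -, hfg⟩ := (hL f g).mp hfg
    change A' f.1 g.1
    exact hfg ▸ (hA' f.1 f.2).mpr ⟨hAf, hf⟩
end

section
/- Let D be a directed graph on a finite nonempty vertex set V with irreflexive arc relation A (no self-loops). Define the simple undirected graph H on vertex set V × {0,1,2} whose edges are: {(i,0),(i,1)} and {(i,1),(i,2)} for every i ∈ V, and {(i,2),(j,0)} for every pair (i,j) with A i j. Then D has a directed Hamiltonian cycle — that is, an enumeration v₀, v₁, …, v_{N−1} of all N = |V| vertices, each appearing exactly once, with A v_t v_{t+1} for all t < N−1 and A v_{N−1} v₀ — if and only if H has a Hamiltonian cycle (a cycle in H visiting every vertex of H exactly once). -/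
namespace SimpleGraph

variable {α : Type*} {G : SimpleGraph α}

/-- A sequence of consecutively adjacent vertices traces out a walk. -/
lemma exists_walk_of_adj_succ {f : ℕ → α} (hadj : ∀ i, G.Adj (f i) (f (i + 1))) (k : ℕ) :
    ∃ p : G.Walk (f 0) (f k), p.length = k ∧ p.support = (List.range (k + 1)).map f ∧
      p.edges = (List.range k).map fun i ↦ s(f i, f (i + 1)) := by
  induction k with
  | zero => exact ⟨.nil, by simp⟩
  | succ k ih =>
    obtain ⟨p, hl, hs, he⟩ := ih
    refine ⟨p.concat (hadj k), by simp [hl], ?_, ?_⟩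
    · rw [Walk.support_concat, hs, List.range_succ (n := k + 1)]
      simp
    · rw [Walk.edges_concat, he, List.range_succ (n := k)]
      simp

/-- A closed sequence of consecutively adjacent vertices that is injective on one period
traces out a Hamiltonian cycle, provided the period is the number of vertices. -/
lemma exists_isHamiltonianCycle_of_adj_succ [Fintype α] [DecidableEq α] {n : ℕ}
    (hcard : Fintype.card α = n) (hn : 3 ≤ n) {f : ℕ → α}
    (hadj : ∀ i, G.Adj (f i) (f (i + 1))) (hper : f n = f 0)
    (hinj : ∀ i < n, ∀ j < n, f i = f j → i = j) :
    ∃ (a : α) (p : G.Walk a a), p.IsHamiltonianCycle := by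
  obtain ⟨m, rfl⟩ : ∃ m, n = m + 1 := ⟨n - 1, by omega⟩
  obtain ⟨p, hl, hs, he⟩ := exists_walk_of_adj_succ hadj m
  have hclose : G.Adj (f m) (f 0) := hper ▸ hadj m
  refine ⟨f m, .cons hclose p, ?_⟩
  rw [Walk.isHamiltonianCycle_iff_isCycle_and_length_eq, Walk.cons_isCycle_iff]
  refine ⟨⟨?_, ?_⟩, by simp [hl, hcard]⟩
  · rw [Walk.isPath_def, hs]
    refine List.Nodup.map_on (fun i hi j hj h ↦ hinj i ?_ j ?_ h) List.nodup_range
    · simpa using hi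
    · simpa using hj
  · rw [he]
    intro hmem
    obtain ⟨i, hi, h⟩ := List.mem_map.1 hmem
    rw [List.mem_range] at hi
    rcases Sym2.eq_iff.1 h with ⟨h, -⟩ | ⟨h, h'⟩
    · have := hinj _ (by omega) _ (by omega) h
      omega
    · have := hinj _ (by omega) _ (by omega) h
      have := hinj _ (by omega) _ (by omega) h'
      omega

/-- A Hamiltonian cycle, unrolled to a periodic enumeration of the vertices by the integers. -/
lemma Walk.IsHamiltonianCycle.exists_int_enumeration [Fintype α] [DecidableEq α] {a : α}
    {p : G.Walk a a} (hp : p.IsHamiltonianCycle) :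
    ∃ f : ℤ → α, Function.Surjective f ∧ (∀ x, G.Adj (f x) (f (x + 1))) ∧
      ∀ x y, f x = f y ↔ (Fintype.card α : ℤ) ∣ x - y := by
  have hl := hp.length_eq
  have h3 := hp.isCycle.three_le_length
  set n := Fintype.card α
  have hinj := hp.isCycle.getVert_injOn'
  have hlast : p.getVert n = p.getVert 0 := by rw [← hl]; simp
  have hlt (x : ℤ) : (x % n).toNat < n := by
    have := Int.emod_lt_of_pos x (b := n) (by omega)
    omega
  refine ⟨fun x ↦ p.getVert (x % n).toNat, fun b ↦ ?_, fun x ↦ ?_,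
    fun x y ↦ ⟨fun h ↦ ?_, fun h ↦ ?_⟩⟩
  · obtain ⟨k, hk, hkl⟩ := Walk.mem_support_iff_exists_getVert.1 (hp.mem_support b)
    rcases eq_or_lt_of_le hkl with h | h
    · refine ⟨0, ?_⟩
      rw [h, hl, hlast] at hk
      simpa using hk
    · refine ⟨k, ?_⟩
      have : ((k : ℤ) % n).toNat = k := by
        rw [Int.emod_eq_of_lt (by omega) (by omega)]; simp
      simpa [this] using hk
  · have hstep := p.adj_getVert_succ (i := (x % n).toNat) (by rw [hl]; exact hlt x)
    have hx := hlt x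
    have h0 := Int.emod_nonneg x (b := n) (by omega)
    have hmod : (x + 1) % n = (x % n + 1) % n := by simp
    rcases eq_or_lt_of_le (Nat.succ_le_of_lt hx) with h | h
    · have : ((x + 1) % n).toNat = 0 := by
        rw [hmod, show x % n + 1 = n by omega]; simp
      simp only [this]
      rw [Nat.succ_eq_add_one] at h
      rwa [h, hlast] at hstep
    · have : ((x + 1) % n).toNat = (x % n).toNat + 1 := by
        rw [hmod, Int.emod_eq_of_lt (by omega) (by omega)]; omega
      simpa only [this] using hstep
  · have hx := hlt x
    have hy := hlt y
    have := hinj (show (x % n).toNat ≤ p.length - 1 by omega)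
      (show (y % n).toNat ≤ p.length - 1 by omega) h
    have h0 := Int.emod_nonneg x (b := n) (by omega)
    have h1 := Int.emod_nonneg y (b := n) (by omega)
    exact Int.ModEq.dvd (show y % n = x % n by omega)
  · have : y % n = x % n := Int.modEq_iff_dvd.2 h
    simp only [this]

end SimpleGraph

section KarpReduction

variable {V : Type*} {A : V → V → Prop} {H : SimpleGraph (V × Fin 3)}

/-- If a periodic enumeration of the split graph runs through `(i, 1)` towards `(i, 2)`, then three
steps later it does the same at an out-neighbour of `i`. -/
lemma exists_arc_of_int_enumeration
    (hH : ∀ a b : V × Fin 3, H.Adj a b ↔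
      (a.1 = b.1 ∧ ((a.2 = 0 ∧ b.2 = 1) ∨ (a.2 = 1 ∧ b.2 = 0) ∨
                    (a.2 = 1 ∧ b.2 = 2) ∨ (a.2 = 2 ∧ b.2 = 1))) ∨
      (A a.1 b.1 ∧ a.2 = 2 ∧ b.2 = 0) ∨
      (A b.1 a.1 ∧ b.2 = 2 ∧ a.2 = 0))
    {n : ℤ} (hn : 3 ≤ n) {f : ℤ → V × Fin 3} (hsurj : Function.Surjective f)
    (hadj : ∀ x, H.Adj (f x) (f (x + 1))) (hf : ∀ x y, f x = f y ↔ n ∣ x - y)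
    {x : ℤ} {i : V} (h1 : f x = (i, 1)) (h2 : f (x + 1) = (i, 2)) :
    ∃ j, A i j ∧ f (x + 3) = (j, 1) ∧ f (x + 4) = (j, 2) := by
  have hne (y : ℤ) : f y ≠ f (y + 2) := fun h ↦ by
    have := Int.le_of_dvd (by omega) ((hf (y + 2) y).1 h.symm)
    omega
  have hshift (y z d : ℤ) (h : f y = f z) : f (y + d) = f (z + d) := by
    rw [hf] at h ⊢
    simpa using h
  obtain ⟨j, hj, hA⟩ : ∃ j, f (x + 2) = (j, 0) ∧ A i j := by
    have h := (hH _ _).1 (hadj (x + 1))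
    have h' := hne x
    rw [show x + 1 + 1 = x + 2 by ring, h2] at h
    rw [h1] at h'
    generalize f (x + 2) = b at h h' ⊢
    obtain ⟨j, c⟩ := b
    fin_cases c <;> simp_all
  obtain ⟨s, hs⟩ := hsurj (j, 1)
  have hnext := (hH _ _).1 (hadj s)
  have hprev := (hH _ _).1 (hadj (s - 1))
  have hdiff := hne (s - 1)
  rw [show s - 1 + 1 = s by ring] at hprev
  rw [show s - 1 + 2 = s + 1 by ring] at hdiff
  have hcases : (f (s - 1) = (j, 0) ∧ f (s + 1) = (j, 2)) ∨ f (s + 1) = (j, 0) := by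
    rw [hs] at hnext hprev
    generalize f (s - 1) = b at *
    generalize f (s + 1) = c at *
    obtain ⟨b, b'⟩ := b
    obtain ⟨c, c'⟩ := c
    fin_cases b' <;> fin_cases c' <;> simp_all
  rcases hcases with ⟨h, h'⟩ | h
  · have e1 := hshift _ _ 1 (hj.trans h.symm)
    have e2 := hshift _ _ 2 (hj.trans h.symm)
    refine ⟨j, hA, ?_, ?_⟩
    · rwa [show x + 2 + 1 = x + 3 by ring, show s - 1 + 1 = s by ring, hs] at e1
    · rwa [show x + 2 + 2 = x + 4 by ring, show s - 1 + 2 = s + 1 by ring, h'] at e2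
  · have e := hshift _ _ (-1) (hj.trans h.symm)
    rw [show x + 2 + -1 = x + 1 by ring, show s + 1 + -1 = s by ring, hs, h2] at e
    simp at e

/-- A Hamiltonian cycle of the split graph can be enumerated starting with a step from some
`(i, 1)` to `(i, 2)`. -/
lemma exists_oriented_int_enumeration [Nonempty V]
    (hH : ∀ a b : V × Fin 3, H.Adj a b ↔
      (a.1 = b.1 ∧ ((a.2 = 0 ∧ b.2 = 1) ∨ (a.2 = 1 ∧ b.2 = 0) ∨
                    (a.2 = 1 ∧ b.2 = 2) ∨ (a.2 = 2 ∧ b.2 = 1))) ∨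
      (A a.1 b.1 ∧ a.2 = 2 ∧ b.2 = 0) ∨
      (A b.1 a.1 ∧ b.2 = 2 ∧ a.2 = 0))
    {n : ℤ} (hn : 3 ≤ n) {f : ℤ → V × Fin 3} (hsurj : Function.Surjective f)
    (hadj : ∀ x, H.Adj (f x) (f (x + 1))) (hf : ∀ x y, f x = f y ↔ n ∣ x - y) :
    ∃ g : ℤ → V × Fin 3, Function.Surjective g ∧ (∀ x, H.Adj (g x) (g (x + 1))) ∧
      (∀ x y, g x = g y ↔ n ∣ x - y) ∧ ∃ i, g 0 = (i, 1) ∧ g 1 = (i, 2) := by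
  obtain ⟨i⟩ := ‹Nonempty V›
  obtain ⟨s, hs⟩ := hsurj (i, 1)
  have hdiff : f (s - 1) ≠ f (s + 1) := fun h ↦ by
    have := Int.le_of_dvd (by omega) ((hf (s + 1) (s - 1)).1 h.symm)
    omega
  have hnext := (hH _ _).1 (hadj s)
  have hprev := (hH _ _).1 (hadj (s - 1))
  rw [show s - 1 + 1 = s by ring] at hprev
  have hcases : f (s + 1) = (i, 2) ∨ f (s - 1) = (i, 2) := by
    rw [hs] at hnext hprev
    generalize f (s - 1) = b at *
    generalize f (s + 1) = c at *
    obtain ⟨b, b'⟩ := b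
    obtain ⟨c, c'⟩ := c
    fin_cases b' <;> fin_cases c' <;> simp_all
  rcases hcases with h | h
  · refine ⟨fun x ↦ f (s + x), fun b ↦ ?_, fun x ↦ ?_, fun x y ↦ ?_, i, by simpa using hs, h⟩
    · obtain ⟨t, rfl⟩ := hsurj b
      exact ⟨t - s, by simp⟩
    · simpa [add_assoc] using hadj (s + x)
    · rw [hf]; simp
  · refine ⟨fun x ↦ f (s - x), fun b ↦ ?_, fun x ↦ ?_, fun x y ↦ ?_, i, by simpa using hs, h⟩
    · obtain ⟨t, rfl⟩ := hsurj b
      exact ⟨s - t, by simp⟩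
    · have := (hadj (s - (x + 1))).symm
      rwa [show s - (x + 1) + 1 = s - x by ring] at this
    · rw [hf, dvd_sub_comm]; ring_nf

end KarpReduction

/-- Correctness of Karp's reduction from Directed HCP to Undirected HCP: each
vertex `i` of the digraph is replaced by the path `(i,0) – (i,1) – (i,2)` and
each arc `(i,j)` becomes the undirected edge `{(i,2), (j,0)}`. -/
theorem directed_hcp_to_undirected_hcp {V : Type*} [Fintype V] [DecidableEq V]
    [Nonempty V] (A : V → V → Prop) (hirr : ∀ i, ¬ A i i)
    (H : SimpleGraph (V × Fin 3))
    (hH : ∀ a b : V × Fin 3, H.Adj a b ↔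
      (a.1 = b.1 ∧ ((a.2 = 0 ∧ b.2 = 1) ∨ (a.2 = 1 ∧ b.2 = 0) ∨
                    (a.2 = 1 ∧ b.2 = 2) ∨ (a.2 = 2 ∧ b.2 = 1))) ∨
      (A a.1 b.1 ∧ a.2 = 2 ∧ b.2 = 0) ∨
      (A b.1 a.1 ∧ b.2 = 2 ∧ a.2 = 0)) :
    (∃ v : Fin (Fintype.card V) → V, Function.Bijective v ∧
      ∀ t : Fin (Fintype.card V), A (v t) (v (t + 1))) ↔
    (∃ (a : V × Fin 3) (p : H.Walk a a), p.IsHamiltonianCycle) := by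
  constructor
  · rintro ⟨v, hv, hA⟩
    let w (k : ℕ) : V := v (Fin.ofNat (Fintype.card V) k)
    have hw (k : ℕ) : A (w k) (w (k + 1)) := by
      have h : Fin.ofNat (Fintype.card V) k + 1 = Fin.ofNat (Fintype.card V) (k + 1) := by
        ext; simp [Fin.val_add]
      simpa only [w, h] using hA (Fin.ofNat (Fintype.card V) k)
    have hN2 : 2 ≤ Fintype.card V := by
      by_contra! h
      have : Subsingleton V := Fintype.card_le_one_iff_subsingleton.1 (by omega)
      exact hirr (w 0) (by simpa only [Subsingleton.elim (w 1) (w 0)] using hw 0)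
    refine SimpleGraph.exists_isHamiltonianCycle_of_adj_succ (n := 3 * Fintype.card V)
      (f := fun k ↦ (w (k / 3), Fin.ofNat 3 k)) (by simp [mul_comm]) (by omega) ?_ ?_ ?_
    · intro k
      rw [hH]
      obtain ⟨q, h | h | h⟩ : ∃ q, k = 3 * q ∨ k = 3 * q + 1 ∨ k = 3 * q + 2 :=
        ⟨k / 3, by omega⟩
      · refine .inl ⟨?_, .inl ⟨?_, ?_⟩⟩
        · change w _ = w _
          congr 1
          omega
        · ext; simp; omega
        · ext; simp; omega
      · refine .inl ⟨?_, .inr (.inr (.inl ⟨?_, ?_⟩))⟩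
        · change w _ = w _
          congr 1
          omega
        · ext; simp; omega
        · ext; simp; omega
      · refine .inr (.inl ⟨?_, ?_, ?_⟩)
        · simpa only [show (k + 1) / 3 = k / 3 + 1 by omega] using hw (k / 3)
        · ext; simp; omega
        · ext; simp; omega
    · have : w (Fintype.card V) = w 0 := congrArg v (by ext; simp)
      refine Prod.ext ?_ ?_
      · simpa using this
      · ext; simp
    · intro i hi j hj h
      have h1 := congrArg Fin.val (hv.1 (congrArg Prod.fst h))
      have h2 := congrArg Fin.val (congrArg Prod.snd h)
      simp only [Fin.val_ofNat] at h1 h2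
      rw [Nat.mod_eq_of_lt (by omega), Nat.mod_eq_of_lt (by omega)] at h1
      omega
  · rintro ⟨a, p, hp⟩
    obtain ⟨f, hsurj, hadj, hf⟩ := hp.exists_int_enumeration
    have hpos : 0 < Fintype.card V := Fintype.card_pos
    have hcard : (Fintype.card (V × Fin 3) : ℤ) = 3 * Fintype.card V := by simp [mul_comm]
    rw [hcard] at hf
    obtain ⟨g, hsurj, hadj, hg, i, h0, h1⟩ :=
      exists_oriented_int_enumeration hH (by omega) hsurj hadj hf
    have hstep {x : ℤ} {i : V} := exists_arc_of_int_enumeration hH (by omega) hsurj hadj hg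
      (x := x) (i := i)
    have hmid (k : ℕ) : g (3 * k) = ((g (3 * k)).1, 1) ∧ g (3 * k + 1) = ((g (3 * k)).1, 2) := by
      induction k with
      | zero => simp [h0, h1]
      | succ k ih =>
        obtain ⟨j, -, h3, h4⟩ := hstep ih.1 ih.2
        rw [show (3 * (k + 1 : ℕ) : ℤ) = 3 * k + 3 by push_cast; ring,
          show (3 * k + 3 + 1 : ℤ) = 3 * k + 4 by ring]
        simp [h3, h4]
    have harc (k : ℕ) : A (g (3 * k)).1 (g (3 * (k + 1 : ℕ))).1 := by
      obtain ⟨j, hA, h3, -⟩ := hstep (hmid k).1 (hmid k).2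
      rw [show (3 * (k + 1 : ℕ) : ℤ) = 3 * k + 3 by push_cast; ring, h3]
      exact hA
    refine ⟨fun t ↦ (g (3 * (t : ℕ))).1, ?_, fun t ↦ ?_⟩
    · rw [Fintype.bijective_iff_injective_and_card]
      refine ⟨fun s t h ↦ ?_, by simp⟩
      have hst : g (3 * (s : ℕ)) = g (3 * (t : ℕ)) := by
        rw [(hmid s).1, (hmid t).1]
        exact congrArg (·, 1) h
      rw [hg, ← mul_sub] at hst
      have hdvd := Int.dvd_of_mul_dvd_mul_left (by norm_num) hst
      have := Int.eq_zero_of_abs_lt_dvd hdvd (by rw [abs_lt]; omega)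
      omega
    · have hwrap : g (3 * (t + 1 : Fin _).val) = g (3 * ((t : ℕ) + 1 : ℕ)) := by
        rw [hg, ← mul_sub]
        refine mul_dvd_mul_left 3 (Int.modEq_iff_dvd.1 ?_)
        rw [Fin.val_add]
        simp [Int.ModEq]
      simpa only [hwrap] using harc t
end

section
/- Let m, n be natural numbers. For each clause i ∈ {1,…,n}, let c_i : {1,2,3} → {1,…,m} be an injective function giving the variable indices of the three literals of clause i, and let b_i : {1,2,3} → Bool indicate whether each literal is complemented. Let d_i be the number of k ∈ {1,2,3} with b_i(k) = true, and for j ∈ {1,…,m} let w_{ij} = Σ_{k : c_i(k) = j} (if b_i(k) then −1 else 1) (an integer in {−1,0,1}). Then there exists a truth assignment t : {1,…,m} → Bool such that every clause is satisfied — i.e., for each i there is some k ∈ {1,2,3} with t(c_i(k)) ≠ b_i(k) — if and only if there exists x : {1,…,m} → {0,1} such that for every i ∈ {1,…,n}, Σ_{j=1}^{m} w_{ij}·x(j) ≥ 1 − d_i (an inequality between integers). -/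
/-- Weights collected by variable give the same linear form as summing over literals. -/
theorem sum_sum_filter_mul {ι κ R : Type*} [Fintype ι] [Fintype κ] [DecidableEq κ]
    [NonUnitalNonAssocSemiring R] (f : ι → κ) (s : ι → R) (x : κ → R) :
    ∑ j, (∑ k ∈ Finset.univ.filter (fun k => f k = j), s k) * x j = ∑ k, s k * x (f k) := by
  rw [← Finset.sum_fiberwise Finset.univ f]
  refine Finset.sum_congr rfl fun j _ => ?_
  rw [Finset.sum_mul]
  refine Finset.sum_congr rfl fun k hk => ?_
  rw [(Finset.mem_filter.1 hk).2]

/-- The linear constraint of a clause says that at least one of its literals has value `1`. -/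
theorem one_sub_card_le_sum_iff {ι : Type*} [Fintype ι] (b t : ι → Bool) :
    1 - ((Finset.univ.filter fun k => b k = true).card : ℤ) ≤
        ∑ k, (if b k then (-1 : ℤ) else 1) * (if t k then 1 else 0) ↔
      ∃ k, t k ≠ b k := by
  have hsum : ((Finset.univ.filter fun k => b k = true).card : ℤ) +
      ∑ k, (if b k then (-1 : ℤ) else 1) * (if t k then 1 else 0) =
      ((Finset.univ.filter fun k => t k ≠ b k).card : ℤ) := by
    rw [Finset.card_filter, Finset.card_filter]
    push_cast
    rw [← Finset.sum_add_distrib]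
    refine Finset.sum_congr rfl fun k _ => ?_
    cases b k <;> cases t k <;> simp
  have hpos : 0 < (Finset.univ.filter fun k => t k ≠ b k).card ↔ ∃ k, t k ≠ b k := by
    simp [Finset.card_pos, Finset.Nonempty]
  rw [← hpos]
  omega

/-- Correctness of Karp's reduction from 3-SAT to 0-1 Integer Programming. -/
theorem three_sat_to_zero_one_IP (m n : ℕ)
    (c : Fin n → Fin 3 → Fin m) (hc : ∀ i, Function.Injective (c i))
    (b : Fin n → Fin 3 → Bool)
    (d : Fin n → ℕ)
    (hd : ∀ i, d i = (Finset.univ.filter fun k => b i k = true).card)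
    (w : Fin n → Fin m → ℤ)
    (hw : ∀ i j, w i j =
      ∑ k ∈ Finset.univ.filter (fun k => c i k = j),
        (if b i k then (-1 : ℤ) else 1)) :
    (∃ t : Fin m → Bool, ∀ i, ∃ k : Fin 3, t (c i k) ≠ b i k) ↔
    ∃ x : Fin m → ℤ, (∀ j, x j = 0 ∨ x j = 1) ∧
      ∀ i, 1 - (d i : ℤ) ≤ ∑ j, w i j * x j := by
  have key (t : Fin m → Bool) (i : Fin n) :
      1 - (d i : ℤ) ≤ ∑ j, w i j * (if t j then 1 else 0) ↔ ∃ k, t (c i k) ≠ b i k := by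
    simp_rw [hd, hw]
    rw [sum_sum_filter_mul (c i) _ fun j => if t j then (1 : ℤ) else 0]
    exact one_sub_card_le_sum_iff (b i) fun k => t (c i k)
  constructor
  · rintro ⟨t, ht⟩
    refine ⟨fun j => if t j then 1 else 0, fun j => ?_, fun i => (key t i).2 (ht i)⟩
    cases t j <;> simp
  · rintro ⟨x, hx, h⟩
    have hxt : x = fun j => if decide (x j = 1) then (1 : ℤ) else 0 := by
      funext j
      rcases hx j with hj | hj <;> simp [hj]
    refine ⟨fun j => decide (x j = 1), fun i => (key (fun j => decide (x j = 1)) i).1 ?_⟩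
    exact (h i).trans_eq (Finset.sum_congr rfl fun j _ => congrArg (w i j * ·) (congrFun hxt j))
end

section
/- Let U be a finite set and let S₁, …, S_s be finite subsets of U with ⋃_{i=1}^{s} S_i = U. Then there exists a set I ⊆ {1,…,s} such that the sets S_i for i ∈ I are pairwise disjoint (for distinct indices in I) and ⋃_{i ∈ I} S_i = U, if and only if there exists x : {1,…,s} → {0,1} such that for every j ∈ U, Σ_{i : j ∈ S_i} x(i) = 1. -/
/-- Correctness of the reduction from Exact Cover to 0-1 Integer Programming. -/
theorem exact_cover_to_zero_one_IP {U : Type*} [Fintype U] [DecidableEq U]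
    (s : ℕ) (S : Fin s → Finset U)
    (hU : Finset.univ.biUnion S = (Finset.univ : Finset U)) :
    (∃ I : Finset (Fin s),
      ((I : Set (Fin s)).Pairwise fun i i' => Disjoint (S i) (S i')) ∧
      I.biUnion S = (Finset.univ : Finset U)) ↔
    ∃ x : Fin s → ℕ, (∀ i, x i ≤ 1) ∧
      ∀ j : U, ∑ i ∈ Finset.univ.filter (fun i => j ∈ S i), x i = 1 := by
  constructor
  · rintro ⟨I, hdisj, hcover⟩
    refine ⟨fun i => if i ∈ I then 1 else 0, fun i => by dsimp only; split_ifs <;> simp,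
      fun j => ?_⟩
    obtain ⟨k, hkI, hk⟩ := Finset.mem_biUnion.1 (hcover ▸ Finset.mem_univ j)
    rw [Finset.sum_eq_single_of_mem k (by simpa using hk), if_pos hkI]
    intro i hi hik
    refine if_neg fun hiI => ?_
    exact Finset.disjoint_left.1 (hdisj hiI hkI hik) (Finset.mem_filter.1 hi).2 hk
  · rintro ⟨x, -, hsum⟩
    refine ⟨Finset.univ.filter fun i => x i = 1, ?_, ?_⟩
    · intro i hi i' hi' hne
      refine Finset.disjoint_left.2 fun j hj hj' => ?_
      have hle : ∑ k ∈ {i, i'}, x k ≤ ∑ k ∈ Finset.univ.filter (fun k => j ∈ S k), x k :=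
        Finset.sum_le_sum_of_subset (by simp [Finset.insert_subset_iff, hj, hj'])
      simp only [Finset.coe_filter, Finset.mem_univ, true_and, Set.mem_ofPred_eq] at hi hi'
      rw [hsum j, Finset.sum_pair hne, hi, hi'] at hle
      omega
    · refine Finset.eq_univ_of_forall fun j => ?_
      obtain ⟨i, hi, hxi⟩ := Finset.exists_ne_zero_of_sum_ne_zero
        ((hsum j).trans_ne one_ne_zero)
      have hle : x i ≤ 1 := hsum j ▸ Finset.single_le_sum_of_canonicallyOrdered hi
      exact Finset.mem_biUnion.2
        ⟨i, by simpa using (by omega : x i = 1), (Finset.mem_filter.1 hi).2⟩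
end

section
/- Let T be a finite set and let u₁, …, u_s be distinct elements of T × T × T. Then there exists a set W ⊆ {1,…,s} with |W| = |T| such that no two distinct indices in W have triples agreeing in any coordinate (for all i ≠ i' in W and all k ∈ {1,2,3}, the k-th coordinates of u_i and u_{i'} differ), if and only if there exists x : {1,…,s} → {0,1} such that for every j ∈ T and every coordinate k ∈ {1,2,3}, Σ_{i : the k-th coordinate of u_i equals j} x(i) = 1. -/
/-- A map from a finset `W` to a finite type `T` has all fibres over `T` of size one if and only if
`W` has as many elements as `T` and the map is injective on `W`. -/
theorem Finset.forall_card_fiber_eq_one_iff {ι T : Type*} [Fintype T] [DecidableEq T]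
    (W : Finset ι) (f : ι → T) :
    (∀ j, (W.filter fun i => f i = j).card = 1) ↔
      W.card = Fintype.card T ∧ Set.InjOn f W := by
  constructor
  · intro h
    refine ⟨?_, fun a ha b hb hab => ?_⟩
    · rw [Finset.card_eq_sum_card_fiberwise (f := f) (t := Finset.univ) (by simp)]
      simp [h]
    · exact Finset.card_le_one.1 (h (f b)).le a (by simpa [hab] using ha) b (by simpa using hb)
  · rintro ⟨hcard, hinj⟩ j
    have himage : W.image f = Finset.univ := by
      rw [← Finset.card_eq_iff_eq_univ, Finset.card_image_of_injOn hinj, hcard]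
    obtain ⟨i, hi, rfl⟩ := Finset.mem_image.1 (himage ▸ Finset.mem_univ j)
    refine Finset.card_eq_one.2 ⟨i, Finset.ext fun a => ?_⟩
    simp only [Finset.mem_filter, Finset.mem_singleton]
    exact ⟨fun ha => hinj ha.1 hi ha.2, by rintro rfl; exact ⟨hi, rfl⟩⟩

/-- Summing a zero-one function over a finset counts the members where it equals one. -/
theorem Finset.sum_eq_card_filter_eq_one {ι : Type*} (s : Finset ι) (x : ι → ℕ)
    (hx : ∀ i, x i ≤ 1) : ∑ i ∈ s, x i = (s.filter fun i => x i = 1).card := by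
  rw [Finset.card_filter]
  refine Finset.sum_congr rfl fun i _ => ?_
  have := hx i
  split_ifs <;> omega

/-- Correctness of the reduction from 3-Dimensional Matching to 0-1 Integer
Programming. -/
theorem three_dimensional_matching_to_zero_one_IP {T : Type*} [Fintype T]
    [DecidableEq T] (s : ℕ) (u : Fin s → T × T × T) (hu : Function.Injective u)
    (coord : T × T × T → Fin 3 → T)
    (hcoord : ∀ p : T × T × T, coord p 0 = p.1 ∧ coord p 1 = p.2.1 ∧
      coord p 2 = p.2.2) :
    (∃ W : Finset (Fin s), W.card = Fintype.card T ∧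
      ∀ i ∈ W, ∀ i' ∈ W, i ≠ i' → ∀ k : Fin 3, coord (u i) k ≠ coord (u i') k) ↔
    ∃ x : Fin s → ℕ, (∀ i, x i ≤ 1) ∧
      ∀ (j : T) (k : Fin 3),
        ∑ i ∈ Finset.univ.filter (fun i => coord (u i) k = j), x i = 1 := by
  constructor
  · rintro ⟨W, hcard, hW⟩
    refine ⟨fun i => if i ∈ W then 1 else 0, fun i => by dsimp only; split_ifs <;> simp,
      fun j k => ?_⟩
    have hinj : Set.InjOn (fun i => coord (u i) k) W := fun a ha b hb hab =>
      by_contra fun hne => hW a ha b hb hne k hab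
    have hfib := (Finset.forall_card_fiber_eq_one_iff W _).2 ⟨hcard, hinj⟩ j
    rw [← Finset.card_filter, Finset.filter_filter, ← hfib]
    congr 1
    ext i
    simp [and_comm]
  · rintro ⟨x, hx, hsum⟩
    have hfib (k : Fin 3) := (Finset.forall_card_fiber_eq_one_iff
      (Finset.univ.filter fun i => x i = 1) fun i => coord (u i) k).1 fun j => by
        rw [Finset.filter_comm, ← Finset.sum_eq_card_filter_eq_one _ _ hx, hsum]
    exact ⟨_, (hfib 0).1, fun a ha b hb hne k hab => hne ((hfib k).2 ha hb hab)⟩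
end

section
/- Let G be a simple graph on a finite vertex set V with edge set E, let w : E → ℕ assign a weight to each edge, let W be a natural number, and let TW = Σ_{e ∈ E} w(e). Then there exists a set S ⊆ V such that the sum of w(e) over all edges e with exactly one endpoint in S is at least W, if and only if there exist x : V → {0,1} and y : E → {0,1} such that: for every edge e = {i,j}, y(e) − x(i) + x(j) ≤ 1, y(e) − x(j) + x(i) ≤ 1, y(e) + x(i) + x(j) ≥ 1, and y(e) − x(i) − x(j) ≥ −1; and Σ_{e ∈ E} w(e)·y(e) ≤ TW − W. -/
theorem exists_mem_notMem_sym2_eq_iff {V : Type*} (S : Finset V) (a b : V) :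
    (∃ i ∈ S, ∃ j ∉ S, s(a, b) = s(i, j)) ↔ (a ∈ S ∧ b ∉ S) ∨ (b ∈ S ∧ a ∉ S) := by
  constructor
  · rintro ⟨i, hi, j, hj, h⟩
    rcases Sym2.eq_iff.1 h with ⟨rfl, rfl⟩ | ⟨rfl, rfl⟩
    · exact Or.inl ⟨hi, hj⟩
    · exact Or.inr ⟨hi, hj⟩
  · rintro (⟨ha, hb⟩ | ⟨hb, ha⟩)
    · exact ⟨a, ha, b, hb, rfl⟩
    · exact ⟨b, hb, a, ha, Sym2.eq_swap⟩

/-- If `y` is the indicator of the complement of `p` on `E`, then weighting by `y` gives the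
total weight minus the weight of `p`. -/
theorem sum_mul_eq_sum_sub_sum_filter {α : Type*} (E : Finset α) (p : α → Prop)
    [DecidablePred p] (w : α → ℕ) (y : α → ℤ) (hy : ∀ e ∈ E, y e = if p e then 0 else 1) :
    ∑ e ∈ E, (w e : ℤ) * y e =
      ((∑ e ∈ E, w e : ℕ) : ℤ) - ((∑ e ∈ E.filter p, w e : ℕ) : ℤ) := by
  push_cast
  rw [Finset.sum_filter, ← Finset.sum_sub_distrib]
  refine Finset.sum_congr rfl fun e he => ?_
  rw [hy e he]
  split_ifs <;> simp

/-- Correctness of the reduction from Max Cut to 0-1 Integer Programming. -/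
theorem max_cut_to_zero_one_IP {V : Type*} [Fintype V] [DecidableEq V]
    (G : SimpleGraph V) [DecidableRel G.Adj] (w : Sym2 V → ℕ) (W : ℕ)
    (TW : ℕ) (hTW : TW = ∑ e ∈ G.edgeFinset, w e) :
    (∃ S : Finset V,
      W ≤ ∑ e ∈ G.edgeFinset.filter (fun e => ∃ i ∈ S, ∃ j ∉ S, e = s(i, j)),
            w e) ↔
    ∃ (x : V → ℤ) (y : Sym2 V → ℤ),
      (∀ i, x i = 0 ∨ x i = 1) ∧
      (∀ e ∈ G.edgeFinset, y e = 0 ∨ y e = 1) ∧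
      (∀ i j, G.Adj i j →
        y s(i, j) - x i + x j ≤ 1 ∧
        y s(i, j) - x j + x i ≤ 1 ∧
        1 ≤ y s(i, j) + x i + x j ∧
        -1 ≤ y s(i, j) - x i - x j) ∧
      ∑ e ∈ G.edgeFinset, (w e : ℤ) * y e ≤ (TW : ℤ) - (W : ℤ) := by
  subst hTW
  constructor
  · rintro ⟨S, hS⟩
    refine ⟨fun i => if i ∈ S then 0 else 1,
      fun e => if ∃ i ∈ S, ∃ j ∉ S, e = s(i, j) then 0 else 1, ?_, ?_, ?_, ?_⟩
    · intro i
      dsimp only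
      split_ifs <;> simp
    · intro e _
      dsimp only
      split_ifs <;> simp
    · intro i j _
      simp only [exists_mem_notMem_sym2_eq_iff]
      by_cases hi : i ∈ S <;> by_cases hj : j ∈ S <;> simp [hi, hj]
    · rw [sum_mul_eq_sum_sub_sum_filter G.edgeFinset
        (fun e => ∃ i ∈ S, ∃ j ∉ S, e = s(i, j)) w _ fun e _ => rfl]
      omega
  · rintro ⟨x, y, hx, hy, hxy, hsum⟩
    obtain ⟨S, hS⟩ : ∃ S : Finset V, ∀ i, i ∈ S ↔ x i = 0 :=
      ⟨Finset.univ.filter fun i => x i = 0, by simp⟩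
    refine ⟨S, ?_⟩
    rw [sum_mul_eq_sum_sub_sum_filter G.edgeFinset
      (fun e => ∃ i ∈ S, ∃ j ∉ S, e = s(i, j)) w y] at hsum
    · omega
    · intro e he
      induction e using Sym2.ind with
      | _ a b =>
        have hab := hxy a b (by simpa using he)
        have hyab := hy _ he
        have ha := hx a
        have hb := hx b
        simp only [exists_mem_notMem_sym2_eq_iff S a b]
        simp only [hS]
        split_ifs <;> omega
end
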